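/- For every real ν > 0 and all natural numbers n ≠ m, the Meixner–Pollaczek functions λ ↦ p_{ν,n}(λ) are orthogonal with respect to the weight |Γ(ν/2 + iλ)|² on the real line: ∫_ℝ p_{ν,n}(λ) · conj(p_{ν,m}(λ)) · |Γ(ν/2 + iλ)|² dλ = 0, where Γ denotes the complex Gamma function and the integral converges absolutely. -/

import Mathlib

open MeasureTheory

/-- `G_{ν,λ}(x) = (1−x²)^{−ν/2} · exp(iλ · log((1+x)/(1−x)))` for real `x` with `|x| < 1`. -/
noncomputable def GFun (ν : ℝ) (lam : ℂ) (x : ℝ) : ℂ :=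
  (((1 - x ^ 2) ^ (-ν / 2) : ℝ) : ℂ) *
    Complex.exp (Complex.I * lam * (Real.log ((1 + x) / (1 - x)) : ℝ))

/-- The real power series with a given sequence of complex coefficients. -/
noncomputable def seriesOfCoeff (c : ℕ → ℂ) : FormalMultilinearSeries ℝ ℝ ℂ :=
  fun n => ContinuousMultilinearMap.mkPiRing ℝ (Fin n) (c n)

@[simp]
theorem coeff_seriesOfCoeff (c : ℕ → ℂ) (n : ℕ) : (seriesOfCoeff c).coeff n = c n := by
  simp [FormalMultilinearSeries.coeff, seriesOfCoeff]

theorem hasFPowerSeriesAt_zero_of_hasSum {c : ℕ → ℂ} {f : ℝ → ℂ} {r : ℝ} (hr : 0 < r)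
    (h : ∀ x : ℝ, |x| < r → HasSum (fun k : ℕ => c k * (x : ℂ) ^ k) (f x)) :
    HasFPowerSeriesAt f (seriesOfCoeff c) 0 := by
  rw [hasFPowerSeriesAt_iff]
  filter_upwards [Metric.ball_mem_nhds (0 : ℝ) hr] with x hx
  convert! h x (by simpa using hx) using 1
  · ext k
    simp [mul_comm]
  · simp

theorem coeff_eq_zero_of_hasSum_zero {c : ℕ → ℂ} {r : ℝ} (hr : 0 < r)
    (h : ∀ x : ℝ, |x| < r → HasSum (fun k : ℕ => c k * (x : ℂ) ^ k) 0) (n : ℕ) : c n = 0 := by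
  have h0 := (hasFPowerSeriesAt_zero_of_hasSum hr h).eq_zero
  rw [← coeff_seriesOfCoeff c n, h0]
  rfl

theorem hasSum_deriv_of_hasSum {c : ℕ → ℂ} {f : ℝ → ℂ} {r : ℝ} (hr : 0 < r)
    (h : ∀ x : ℝ, |x| < r → HasSum (fun k : ℕ => c k * (x : ℂ) ^ k) (f x)) :
    ∃ r' > 0, ∀ x : ℝ, |x| < r' →
      HasSum (fun k : ℕ => ((k + 1) * c (k + 1)) * (x : ℂ) ^ k) (deriv f x) := by
  obtain ⟨R, hR⟩ := hasFPowerSeriesAt_zero_of_hasSum hr h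
  obtain ⟨r', hr₀, hr'⟩ := ENNReal.lt_iff_exists_nnreal_btwn.1 hR.r_pos
  refine ⟨r', by exact_mod_cast hr₀, fun x hx => ?_⟩
  have hxR : x ∈ Metric.eball (0 : ℝ) R := by
    refine lt_of_le_of_lt ?_ hr'
    rw [edist_dist]
    simpa using ENNReal.ofReal_le_ofReal hx.le
  have h1 := (hR.fderiv.hasSum hxR).mapL (ContinuousLinearMap.apply ℝ ℂ (1 : ℝ))
  convert! h1 using 1
  · ext k
    simp [FormalMultilinearSeries.derivSeries_coeff_one]
    ring
  · simp

/-- Prepending a zero to a sequence, which multiplies its generating function by the variable. -/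
def shiftSeq (c : ℕ → ℂ) : ℕ → ℂ
  | 0 => 0
  | k + 1 => c k

theorem HasSum.shiftSeq_mul_pow {c : ℕ → ℂ} {x s : ℂ} (h : HasSum (fun k : ℕ => c k * x ^ k) s) :
    HasSum (fun k : ℕ => shiftSeq c k * x ^ k) (x * s) := by
  rw [← hasSum_nat_add_iff' 1]
  convert! h.mul_left x using 1
  · ext k
    simp only [shiftSeq]
    ring
  · simp [shiftSeq]

theorem hasDerivAt_GFun (ν : ℝ) (lam : ℂ) {x : ℝ} (hx : |x| < 1) :
    HasDerivAt (GFun ν lam) ((ν * x + 2 * Complex.I * lam) / (1 - x ^ 2) * GFun ν lam x) x := by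
  obtain ⟨h1, h2⟩ := abs_lt.1 hx
  have hp : 0 < 1 + x := by linarith
  have hm : 0 < 1 - x := by linarith
  have hs : 0 < 1 - x ^ 2 := by nlinarith
  have hA : HasDerivAt (fun y : ℝ => 1 - y ^ 2) (-(2 * x)) x := by
    simpa using (hasDerivAt_pow 2 x).const_sub 1
  have hB := (hA.rpow_const (p := -ν / 2) (Or.inl hs.ne')).ofReal_comp
  have hC : HasDerivAt (fun y : ℝ => Real.log ((1 + y) / (1 - y))) (2 / (1 - x ^ 2)) x := by
    have := (((hasDerivAt_id' x).const_add 1).fun_div ((hasDerivAt_id' x).const_sub 1) hm.ne').log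
      (div_pos hp hm).ne'
    refine this.congr_deriv ?_
    have : (1 - x ^ 2) = (1 + x) * (1 - x) := by ring
    rw [this]
    field_simp
    ring
  have hD := ((hC.ofReal_comp).const_mul (Complex.I * lam)).cexp
  refine (hB.mul hD).congr_deriv ?_
  have hr : (1 - x ^ 2) ^ (-ν / 2 - 1) = (1 - x ^ 2) ^ (-ν / 2) / (1 - x ^ 2) := by
    rw [Real.rpow_sub_one hs.ne']
  have hs' : (1 - (x : ℂ) ^ 2) ≠ 0 := by exact_mod_cast hs.ne'
  rw [hr, GFun]
  push_cast
  field_simp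

/-- The Meixner–Pollaczek polynomials (at angle `π / 2`, with complex phases), defined by their
three-term recurrence. -/
noncomputable def meixnerPollaczek (ν lam : ℂ) : ℕ → ℂ
  | 0 => 1
  | 1 => 2 * Complex.I * lam
  | n + 2 => (2 * Complex.I * lam * meixnerPollaczek ν lam (n + 1) +
      (n + ν) * meixnerPollaczek ν lam n) / (n + 2)

@[simp]
theorem meixnerPollaczek_zero (ν z : ℂ) : meixnerPollaczek ν z 0 = 1 := by
  rw [meixnerPollaczek]

@[simp]
theorem meixnerPollaczek_one (ν z : ℂ) : meixnerPollaczek ν z 1 = 2 * Complex.I * z := by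
  rw [meixnerPollaczek]

theorem eq_meixnerPollaczek_of_hasSum_GFun {ν : ℝ} {lam : ℂ} {q : ℕ → ℂ} {r : ℝ} (hr : 0 < r)
    (h : ∀ x : ℝ, |x| < r → HasSum (fun k : ℕ => q k * (x : ℂ) ^ k) (GFun ν lam x)) (n : ℕ) :
    q n = meixnerPollaczek ν lam n := by
  obtain ⟨r', hr', hd⟩ := hasSum_deriv_of_hasSum hr h
  set d : ℕ → ℂ := fun k => (k + 1) * q (k + 1) with hd_def
  have key : ∀ k, d k - shiftSeq (shiftSeq d) k - ν * shiftSeq q k - 2 * Complex.I * lam * q k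
      = 0 := by
    refine coeff_eq_zero_of_hasSum_zero (r := min 1 (min r r')) (by positivity) fun x hx => ?_
    simp only [lt_min_iff] at hx
    have hD := hd x hx.2.2
    have hG := h x hx.2.1
    convert! ((hD.sub hD.shiftSeq_mul_pow.shiftSeq_mul_pow).sub
      (hG.shiftSeq_mul_pow.mul_left (ν : ℂ))).sub (hG.mul_left (2 * Complex.I * lam)) using 1
    · ext k
      simp only [hd_def]
      ring
    · have hs : (1 - (x : ℂ) ^ 2) ≠ 0 := by
        obtain ⟨h1, h2⟩ := abs_lt.1 hx.1
        have : (1 - x ^ 2) ≠ 0 := by nlinarith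
        exact_mod_cast this
      rw [(hasDerivAt_GFun ν lam hx.1).deriv]
      field_simp
      ring
  have h0 : q 0 = 1 := by
    have h1 := (hasSum_ite_eq (0 : ℕ) (q 0)).unique (by
      convert! h 0 (by simpa using hr) using 1
      ext k
      split_ifs with hk <;> simp [hk])
    rw [h1]
    simp [GFun]
  have h1 : q 1 = 2 * Complex.I * lam := by
    have := key 0
    simp only [hd_def, shiftSeq, h0] at this
    push_cast at this
    linear_combination this
  have hrec : ∀ n : ℕ, (n + 2) * q (n + 2) = 2 * Complex.I * lam * q (n + 1) + (n + ν) * q n := by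
    intro n
    have := key (n + 1)
    rcases n with _ | n <;> simp only [hd_def, shiftSeq] at this <;> push_cast at this ⊢ <;>
      linear_combination this
  induction n using Nat.strong_induction_on with
  | _ n ih =>
    match n with
    | 0 => simpa [meixnerPollaczek] using h0
    | 1 => simpa [meixnerPollaczek] using h1
    | n + 2 =>
      rw [meixnerPollaczek, ← ih (n + 1) (by omega), ← ih n (by omega), ← hrec,
        mul_div_cancel_left₀ _ (by exact_mod_cast (by omega : n + 2 ≠ 0))]
theorem integrable_horizontal_line {F : ℂ → ℂ} {t C : ℝ}
    (hF : ∀ x : ℝ, DifferentiableAt ℂ F (x + t * Complex.I))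
    (hC : ∀ x : ℝ, ‖F (x + t * Complex.I)‖ ≤ C * (1 + x ^ 2)⁻¹) :
    Integrable (fun x : ℝ => F (x + t * Complex.I)) := by
  refine (integrable_inv_one_add_sq.const_mul C).mono' ?_ (ae_of_all _ hC)
  refine Continuous.aestronglyMeasurable (continuous_iff_continuousAt.2 fun x => ?_)
  exact ContinuousAt.comp (f := fun x : ℝ => (x : ℂ) + t * Complex.I) (hF x).continuousAt
    (by fun_prop)

open Filter Topology Set in
/-- Horizontal contour shift: a holomorphic function on a closed horizontal strip with quadratic
decay has the same integral along both boundary lines. -/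
theorem integral_horizontal_line_eq_of_differentiableOn_strip {F : ℂ → ℂ} {c d C : ℝ} (hcd : c ≤ d)
    (hF : ∀ z : ℂ, z.im ∈ Icc c d → DifferentiableAt ℂ F z)
    (hC : ∀ z : ℂ, z.im ∈ Icc c d → ‖F z‖ ≤ C * (1 + z.re ^ 2)⁻¹) :
    ∫ x : ℝ, F (x + c * Complex.I) = ∫ x : ℝ, F (x + d * Complex.I) := by
  have hint : ∀ t ∈ Icc c d, Integrable (fun x : ℝ => F (x + t * Complex.I)) := fun t ht =>
    integrable_horizontal_line (fun x => hF _ (by simpa using ht))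
      fun x => by simpa using hC (x + t * Complex.I) (by simpa using ht)
  have hlim : ∀ t ∈ Icc c d, Tendsto (fun T : ℝ => ∫ x in (-T)..T, F (x + t * Complex.I)) atTop
      (𝓝 (∫ x : ℝ, F (x + t * Complex.I))) := fun t ht =>
    intervalIntegral_tendsto_integral (hint t ht) tendsto_neg_atTop_atBot tendsto_id
  have hside : ∀ ε : ℝ, ε ^ 2 = 1 →
      Tendsto (fun T : ℝ => ∫ y in c..d, F ((ε * T : ℝ) + y * Complex.I)) atTop (𝓝 0) := by
    intro ε hε
    refine squeeze_zero_norm (a := fun T : ℝ => C * (1 + T ^ 2)⁻¹ * |d - c|) (fun T => ?_) ?_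
    · refine intervalIntegral.norm_integral_le_of_norm_le_const fun y hy => ?_
      rw [uIoc_of_le hcd] at hy
      have := hC ((ε * T : ℝ) + y * Complex.I) (by simpa using ⟨hy.1.le, hy.2⟩)
      simpa [mul_pow, hε] using this
    · have h1 : Tendsto (fun T : ℝ => (1 + T ^ 2)⁻¹) atTop (𝓝 0) :=
        (tendsto_atTop_add_const_left _ _ (tendsto_pow_atTop two_ne_zero)).inv_tendsto_atTop
      simpa using (h1.const_mul C).mul_const |d - c|
  have hrect : ∀ T : ℝ, (∫ x in (-T)..T, F (x + c * Complex.I)) -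
      (∫ x in (-T)..T, F (x + d * Complex.I)) =
      Complex.I * (∫ y in c..d, F ((-1 * T : ℝ) + y * Complex.I)) -
      Complex.I * (∫ y in c..d, F ((1 * T : ℝ) + y * Complex.I)) := by
    intro T
    have := Complex.integral_boundary_rect_eq_zero_of_differentiableOn F
      (-T + c * Complex.I) (T + d * Complex.I) (by
        intro z hz
        refine (hF z ?_).differentiableWithinAt
        have := hz.2
        simpa [uIcc_of_le hcd] using this)
    simp only [Complex.add_re, Complex.neg_re, Complex.ofReal_re, Complex.mul_re, Complex.I_re,
      Complex.ofReal_im, Complex.I_im, Complex.add_im, Complex.neg_im, Complex.mul_im, mul_zero,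
      mul_one, sub_zero, add_zero, neg_zero, zero_add, smul_eq_mul] at this
    simp only [neg_one_mul, one_mul]
    linear_combination this
  have h1 := (hlim c ⟨le_rfl, hcd⟩).sub (hlim d ⟨hcd, le_rfl⟩)
  simp only [hrect] at h1
  have h2 := ((hside (-1) (by norm_num)).const_mul Complex.I).sub
    ((hside 1 (by norm_num)).const_mul Complex.I)
  have h3 := tendsto_nhds_unique h1 h2
  simpa [sub_eq_zero] using h3

theorem norm_Gamma_le_Gamma_re {s : ℂ} (hs : 0 < s.re) : ‖Complex.Gamma s‖ ≤ Real.Gamma s.re := by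
  rw [Complex.Gamma_eq_integral hs, Real.Gamma_eq_integral hs, Complex.GammaIntegral]
  refine (norm_integral_le_integral_norm _).trans_eq
    (setIntegral_congr_fun measurableSet_Ioi fun x hx => ?_)
  have hx : 0 < x := hx
  have h := Complex.norm_cpow_eq_rpow_re_of_pos hx (s - 1)
  simp only [norm_mul, Complex.norm_real, Real.norm_eq_abs, Real.abs_exp, h]
  simp

/-- On closed vertical strips in the right half plane, the Gamma function decays faster than any
power of the imaginary part. -/
theorem exists_norm_Gamma_mul_pow_le (k : ℕ) {α : ℝ} (hα : 0 < α) (β : ℝ) :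
    ∃ C, ∀ s : ℂ, s.re ∈ Set.Icc α β → ‖Complex.Gamma s‖ * (1 + |s.im|) ^ k ≤ C := by
  induction k generalizing α β with
  | zero =>
    have hc : ContinuousOn Real.Gamma (Set.Icc α β) :=
      Real.differentiableOn_Gamma_Ioi.continuousOn.mono fun x hx => hα.trans_le hx.1
    obtain ⟨C, hC⟩ := isCompact_Icc.bddAbove_image hc
    exact ⟨C, fun s hs => by
      simpa using (norm_Gamma_le_Gamma_re (hα.trans_le hs.1)).trans
        (hC (Set.mem_image_of_mem _ hs))⟩
  | succ k ih =>
    obtain ⟨C, hC⟩ := ih (α := α + 1) (by positivity) (β + 1)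
    refine ⟨(1 + α⁻¹) * C, fun s hs => ?_⟩
    have hre : 0 < s.re := hα.trans_le hs.1
    have hs0 : s ≠ 0 := fun h => by simp [h] at hre
    have h1 := hC (s + 1) (by simpa using hs)
    rw [Complex.Gamma_add_one s hs0, norm_mul] at h1
    simp only [Complex.add_im, Complex.one_im, add_zero] at h1
    have h2 : 1 + |s.im| ≤ (1 + α⁻¹) * ‖s‖ := by
      have h3 : α ≤ ‖s‖ := hs.1.trans ((le_abs_self _).trans (Complex.abs_re_le_norm s))
      have h4 : 1 ≤ α⁻¹ * ‖s‖ := by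
        rw [← inv_mul_cancel₀ hα.ne']
        gcongr
      linarith [Complex.abs_im_le_norm s]
    calc ‖Complex.Gamma s‖ * (1 + |s.im|) ^ (k + 1)
        = (1 + |s.im|) * (‖Complex.Gamma s‖ * (1 + |s.im|) ^ k) := by ring
      _ ≤ (1 + α⁻¹) * ‖s‖ * (‖Complex.Gamma s‖ * (1 + |s.im|) ^ k) := by gcongr
      _ = (1 + α⁻¹) * (‖s‖ * ‖Complex.Gamma s‖ * (1 + |s.im|) ^ k) := by ring
      _ ≤ (1 + α⁻¹) * C := by gcongr

/-- At most polynomial growth on the complex plane. -/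
def PolyGrowth (f : ℂ → ℂ) : Prop := ∃ (C : ℝ) (N : ℕ), ∀ z, ‖f z‖ ≤ C * (1 + ‖z‖) ^ N

theorem PolyGrowth.mul {f g : ℂ → ℂ} (hf : PolyGrowth f) (hg : PolyGrowth g) :
    PolyGrowth fun z => f z * g z := by
  obtain ⟨C, N, hC⟩ := hf
  obtain ⟨D, M, hD⟩ := hg
  refine ⟨C * D, N + M, fun z => ?_⟩
  calc ‖f z * g z‖ = ‖f z‖ * ‖g z‖ := norm_mul _ _
    _ ≤ (C * (1 + ‖z‖) ^ N) * (D * (1 + ‖z‖) ^ M) :=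
      mul_le_mul (hC z) (hD z) (norm_nonneg _) ((norm_nonneg _).trans (hC z))
    _ = C * D * (1 + ‖z‖) ^ (N + M) := by ring

theorem differentiable_meixnerPollaczek (ν : ℂ) (n : ℕ) :
    Differentiable ℂ fun z => meixnerPollaczek ν z n := by
  induction n using Nat.twoStepInduction with
  | zero => simp [meixnerPollaczek]
  | one => simp only [meixnerPollaczek]; fun_prop
  | more n h0 h1 => simp only [meixnerPollaczek]; fun_prop

theorem norm_meixnerPollaczek_le (ν : ℂ) (n : ℕ) :
    ∃ C, 0 ≤ C ∧ ∀ z, ‖meixnerPollaczek ν z n‖ ≤ C * (1 + ‖z‖) ^ n := by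
  induction n using Nat.twoStepInduction with
  | zero => exact ⟨1, by simp [meixnerPollaczek]⟩
  | one => exact ⟨2, by simp [meixnerPollaczek]⟩
  | more n h0 h1 =>
    obtain ⟨C₀, hC₀, h0⟩ := h0
    obtain ⟨C₁, hC₁, h1⟩ := h1
    refine ⟨2 * C₁ + (n + ‖ν‖) * C₀, by positivity, fun z => ?_⟩
    have hn : 1 ≤ ‖(n + 2 : ℂ)‖ := by
      rw [show (n + 2 : ℂ) = ((n + 2 : ℕ) : ℂ) by push_cast; rfl, Complex.norm_natCast]
      push_cast
      linarith [n.cast_nonneg (α := ℝ)]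
    have hν : ‖(n + ν : ℂ)‖ ≤ n + ‖ν‖ := (norm_add_le _ _).trans (by simp)
    rw [meixnerPollaczek, norm_div]
    refine (div_le_self (norm_nonneg _) hn).trans ((norm_add_le _ _).trans ?_)
    have hz : 1 ≤ 1 + ‖z‖ := by simp
    have hp : (1 + ‖z‖) ^ n ≤ (1 + ‖z‖) ^ (n + 2) := pow_le_pow_right₀ hz (by omega)
    calc _ = 2 * ‖z‖ * ‖meixnerPollaczek ν z (n + 1)‖ +
          ‖(n + ν : ℂ)‖ * ‖meixnerPollaczek ν z n‖ := by simp
      _ ≤ 2 * (1 + ‖z‖) * (C₁ * (1 + ‖z‖) ^ (n + 1)) +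
          (n + ‖ν‖) * (C₀ * (1 + ‖z‖) ^ (n + 2)) := by
        gcongr
        · simp
        · exact h1 z
        · exact (h0 z).trans (by gcongr)
      _ = (2 * C₁ + (n + ‖ν‖) * C₀) * (1 + ‖z‖) ^ (n + 2) := by ring

theorem polyGrowth_meixnerPollaczek (ν : ℂ) (n : ℕ) :
    PolyGrowth fun z => meixnerPollaczek ν z n := by
  obtain ⟨C, -, hC⟩ := norm_meixnerPollaczek_le ν n
  exact ⟨C, n, hC⟩

theorem conj_meixnerPollaczek (ν lam : ℝ) (n : ℕ) :
    (starRingEnd ℂ) (meixnerPollaczek ν lam n) = (-1) ^ n * meixnerPollaczek ν lam n := by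
  induction n using Nat.twoStepInduction with
  | zero => simp [meixnerPollaczek]
  | one => simp [meixnerPollaczek, map_ofNat]
  | more n h0 h1 =>
    simp only [meixnerPollaczek, map_div₀, map_add, map_mul, h0, h1, map_ofNat, map_natCast,
      Complex.conj_I, Complex.conj_ofReal]
    ring

theorem meixnerPollaczek_add_two (ν z : ℂ) (n : ℕ) :
    (n + 2) * meixnerPollaczek ν z (n + 2) =
      2 * Complex.I * z * meixnerPollaczek ν z (n + 1) + (n + ν) * meixnerPollaczek ν z n := by
  rw [meixnerPollaczek, mul_div_cancel₀]
  exact_mod_cast (by omega : n + 2 ≠ 0)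

theorem meixnerPollaczek_shift_succ (ν z : ℂ) {ε : ℂ} (hε : ε ^ 2 = 1) (n : ℕ) :
    meixnerPollaczek (ν + 1) (z - ε * Complex.I / 2) (n + 1) =
      ε * meixnerPollaczek (ν + 1) (z - ε * Complex.I / 2) n + meixnerPollaczek ν z (n + 1) := by
  have hn : ∀ n : ℕ, (n + 2 : ℂ) ≠ 0 := fun n => by exact_mod_cast (by omega : n + 2 ≠ 0)
  have h1 : meixnerPollaczek (ν + 1) (z - ε * Complex.I / 2) 1 = ε + 2 * Complex.I * z := by
    simp only [meixnerPollaczek]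
    linear_combination -ε * Complex.I_sq
  induction n using Nat.twoStepInduction with
  | zero =>
    rw [zero_add, h1]
    simp [meixnerPollaczek]
  | one =>
    refine mul_left_cancel₀ (hn 0) ?_
    have hA := meixnerPollaczek_add_two (ν + 1) (z - ε * Complex.I / 2) 0
    have hp := meixnerPollaczek_add_two ν z 0
    simp only [zero_add, Nat.reduceAdd, h1] at hA hp ⊢
    simp only [meixnerPollaczek] at hA hp ⊢
    push_cast at hA hp ⊢
    linear_combination hA - hp - hε - ε * (ε + 2 * Complex.I * z) * Complex.I_sq
  | more n h0 h1 =>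
    refine mul_left_cancel₀ (hn (n + 1)) ?_
    have hA := meixnerPollaczek_add_two (ν + 1) (z - ε * Complex.I / 2) (n + 1)
    have hA' := meixnerPollaczek_add_two (ν + 1) (z - ε * Complex.I / 2) n
    have hp := meixnerPollaczek_add_two ν z (n + 1)
    push_cast at hA hA' hp ⊢
    simp only [add_assoc, Nat.reduceAdd] at hA hA' hp h0 h1 ⊢
    linear_combination hA - hp + 2 * Complex.I * z * h1 + (n + 1 + ν) * h0 - ε * hA' -
      meixnerPollaczek (ν + 1) (z - ε * Complex.I / 2) (n + 1) * hε -
      ε * meixnerPollaczek (ν + 1) (z - ε * Complex.I / 2) (n + 2) * Complex.I_sq +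
      ε ^ 2 * meixnerPollaczek (ν + 1) (z - ε * Complex.I / 2) (n + 1) * Complex.I_sq

theorem meixnerPollaczek_eq_shift (ν z : ℂ) (n : ℕ) :
    (n + 1) * meixnerPollaczek ν z (n + 1) =
      (ν / 2 + Complex.I * z) * meixnerPollaczek (ν + 1) (z - Complex.I / 2) n -
      (ν / 2 - Complex.I * z) * meixnerPollaczek (ν + 1) (z + Complex.I / 2) n ∧
    (n + ν) * meixnerPollaczek ν z n =
      (ν / 2 + Complex.I * z) * meixnerPollaczek (ν + 1) (z - Complex.I / 2) n +
      (ν / 2 - Complex.I * z) * meixnerPollaczek (ν + 1) (z + Complex.I / 2) n := by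
  induction n with
  | zero =>
    simp only [meixnerPollaczek]
    push_cast
    constructor <;> ring
  | succ n ih =>
    obtain ⟨hD, hE⟩ := ih
    have hA := meixnerPollaczek_shift_succ ν z (ε := 1) (by norm_num) n
    have hB := meixnerPollaczek_shift_succ ν z (ε := -1) (by norm_num) n
    rw [show z - 1 * Complex.I / 2 = z - Complex.I / 2 by ring] at hA
    rw [show z - -1 * Complex.I / 2 = z + Complex.I / 2 by ring] at hB
    have hp := meixnerPollaczek_add_two ν z n
    push_cast
    rw [hA, hB]
    exact ⟨by linear_combination hp + hE, by linear_combination hD⟩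

/-- The analytic continuation of the Meixner–Pollaczek weight `|Γ(b + iλ)|²` off the real line. -/
noncomputable def gammaWeight (b : ℝ) (z : ℂ) : ℂ :=
  Complex.Gamma (b + Complex.I * z) * Complex.Gamma (b - Complex.I * z)

theorem gammaWeight_ofReal (b x : ℝ) :
    gammaWeight b x = ((‖Complex.Gamma (b + Complex.I * x)‖ ^ 2 : ℝ) : ℂ) := by
  have h : (b - Complex.I * x : ℂ) = (starRingEnd ℂ) (b + Complex.I * x) := by
    simp [sub_eq_add_neg]
  rw [gammaWeight, h, Complex.Gamma_conj, Complex.mul_conj, Complex.normSq_eq_norm_sq]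

theorem gammaWeight_sub_half {a : ℝ} (ha : 0 < a) (x : ℝ) :
    gammaWeight (a + 1 / 2) (x - Complex.I / 2) = (a + Complex.I * x) * gammaWeight a x := by
  have h0 : (a + Complex.I * x : ℂ) ≠ 0 := fun h => by
    have := congrArg Complex.re h
    simp at this
    linarith
  have h1 : ((a + 1 / 2 : ℝ) + Complex.I * (x - Complex.I / 2) : ℂ) =
      (a + Complex.I * x) + 1 := by
    push_cast
    linear_combination (-1 / 2) * Complex.I_sq
  have h2 : ((a + 1 / 2 : ℝ) - Complex.I * (x - Complex.I / 2) : ℂ) = a - Complex.I * x := by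
    push_cast
    linear_combination (1 / 2) * Complex.I_sq
  rw [gammaWeight, h1, h2, Complex.Gamma_add_one _ h0, gammaWeight]
  ring

theorem gammaWeight_neg (b : ℝ) (z : ℂ) : gammaWeight b (-z) = gammaWeight b z := by
  simp only [gammaWeight, mul_neg, ← sub_eq_add_neg, sub_neg_eq_add]
  ring

theorem gammaWeight_add_half {a : ℝ} (ha : 0 < a) (x : ℝ) :
    gammaWeight (a + 1 / 2) (x + Complex.I / 2) = (a - Complex.I * x) * gammaWeight a x := by
  have h := gammaWeight_sub_half ha (-x)
  rw [← gammaWeight_neg] at h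
  rw [← gammaWeight_neg a]
  push_cast at h ⊢
  rw [← show -(-x - Complex.I / 2 : ℂ) = x + Complex.I / 2 by ring, h]
  ring

theorem differentiableAt_gammaWeight {b : ℝ} {z : ℂ} (hz : |z.im| < b) :
    DifferentiableAt ℂ (gammaWeight b) z := by
  obtain ⟨h1, h2⟩ := abs_lt.1 hz
  have hG : ∀ s : ℂ, 0 < s.re → DifferentiableAt ℂ Complex.Gamma s := fun s hs =>
    Complex.differentiableAt_Gamma s fun m h => by
      have : s.re ≤ 0 := by simp [h]
      linarith
  refine DifferentiableAt.mul ?_ ?_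
  · exact (hG (b + Complex.I * z) (by simpa using by linarith)).comp z
      (f := fun z => (b + Complex.I * z : ℂ)) (by fun_prop)
  · exact (hG (b - Complex.I * z) (by simpa using by linarith)).comp z
      (f := fun z => (b - Complex.I * z : ℂ)) (by fun_prop)

theorem PolyGrowth.exists_norm_mul_gammaWeight_le {f : ℂ → ℂ} (hf : PolyGrowth f) {b h : ℝ}
    (hb : h < b) : ∃ C, ∀ z : ℂ, |z.im| ≤ h →
      ‖f z * gammaWeight b z‖ ≤ C * (1 + z.re ^ 2)⁻¹ := by
  obtain ⟨A, N, hA⟩ := hf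
  obtain ⟨B, hB⟩ := exists_norm_Gamma_mul_pow_le (N + 2) (sub_pos.2 hb) (b + h)
  obtain ⟨D, hD⟩ := exists_norm_Gamma_mul_pow_le 0 (sub_pos.2 hb) (b + h)
  refine ⟨A * (1 + h) ^ N * B * D, fun z hz => ?_⟩
  obtain ⟨h1, h2⟩ := abs_le.1 hz
  have hh : 0 ≤ h := (abs_nonneg _).trans hz
  have hA0 : 0 ≤ A := by simpa using (norm_nonneg _).trans (hA 0)
  have hB' := hB (b + Complex.I * z) (by simpa using ⟨by linarith, by linarith⟩)
  have hD' := hD (b - Complex.I * z) (by simpa using ⟨by linarith, by linarith⟩)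
  simp only [pow_zero, mul_one] at hD'
  have hD0 : 0 ≤ D := (norm_nonneg _).trans hD'
  have him : (b + Complex.I * z : ℂ).im = z.re := by simp
  rw [him] at hB'
  have hB0 : 0 ≤ B := le_trans (by positivity) hB'
  have hz' : 1 + ‖z‖ ≤ (1 + h) * (1 + |z.re|) := by
    have := Complex.norm_le_abs_re_add_abs_im z
    nlinarith [mul_nonneg hh (abs_nonneg z.re)]
  rw [← div_eq_mul_inv, le_div_iff₀ (by positivity), gammaWeight, norm_mul, norm_mul]
  have hsq : 1 + z.re ^ 2 ≤ (1 + |z.re|) ^ 2 := by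
    nlinarith [sq_abs z.re, abs_nonneg z.re]
  calc ‖f z‖ * (‖Complex.Gamma (b + Complex.I * z)‖ * ‖Complex.Gamma (b - Complex.I * z)‖) *
        (1 + z.re ^ 2)
      ≤ A * ((1 + h) * (1 + |z.re|)) ^ N *
        (‖Complex.Gamma (b + Complex.I * z)‖ * D) * (1 + |z.re|) ^ 2 := by
        have hf : ‖f z‖ ≤ A * ((1 + h) * (1 + |z.re|)) ^ N := (hA z).trans (by gcongr)
        gcongr
    _ = A * (1 + h) ^ N * (‖Complex.Gamma (b + Complex.I * z)‖ * (1 + |z.re|) ^ (N + 2)) * D := by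
        rw [mul_pow]
        ring
    _ ≤ A * (1 + h) ^ N * B * D := by
        gcongr

theorem PolyGrowth.integrable_mul_gammaWeight {f : ℂ → ℂ} (hf : PolyGrowth f)
    (hd : Differentiable ℂ f) {b : ℝ} (hb : 0 < b) :
    Integrable fun x : ℝ => f x * gammaWeight b x := by
  obtain ⟨C, hC⟩ := hf.exists_norm_mul_gammaWeight_le hb
  have := integrable_horizontal_line (F := fun z => f z * gammaWeight b z) (t := 0) (C := C)
    (fun x => (hd _).mul (differentiableAt_gammaWeight (by simpa using hb)))
    (fun x => by simpa using hC (x + (0 : ℝ) * Complex.I) (by simp))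
  simpa using this

theorem integral_meixnerPollaczek_succ {ν : ℝ} (hν : 0 < ν) (n : ℕ) :
    ∫ x : ℝ, meixnerPollaczek ν x (n + 1) * gammaWeight (ν / 2) x = 0 := by
  have hf := polyGrowth_meixnerPollaczek (ν + 1) n
  have hd := differentiable_meixnerPollaczek (ν + 1) n
  set F : ℂ → ℂ := fun z => meixnerPollaczek (ν + 1) z n * gammaWeight (ν / 2 + 1 / 2) z with hF_def
  obtain ⟨C, hC⟩ := hf.exists_norm_mul_gammaWeight_le
    (show (1 / 2 : ℝ) < ν / 2 + 1 / 2 by linarith)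
  have hF : ∀ z : ℂ, |z.im| ≤ 1 / 2 → DifferentiableAt ℂ F z := fun z hz =>
    (hd z).mul (differentiableAt_gammaWeight (by linarith))
  have hshift := integral_horizontal_line_eq_of_differentiableOn_strip (F := F)
    (c := -(1 / 2)) (d := 1 / 2) (C := C) (by norm_num)
    (fun z hz => hF z (abs_le.2 hz)) (fun z hz => hC z (abs_le.2 hz))
  have hint : ∀ t : ℝ, |t| ≤ 1 / 2 → Integrable fun x : ℝ => F (x + t * Complex.I) := fun t ht =>
    integrable_horizontal_line (fun x => hF _ (by simpa using ht))
      (C := C) fun x => by simpa [hF_def] using hC (x + t * Complex.I) (by simpa using ht)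
  have hn : ((n : ℂ) + 1) ≠ 0 := by exact_mod_cast n.succ_ne_zero
  refine mul_left_cancel₀ hn ?_
  rw [mul_zero, ← integral_const_mul, ← sub_eq_zero.2 hshift,
    ← integral_sub (hint _ (by norm_num [abs_of_pos])) (hint _ (by norm_num [abs_of_pos]))]
  congr 1 with x
  have h1 : (x + (-(1 / 2) : ℝ) * Complex.I : ℂ) = x - Complex.I / 2 := by
    push_cast
    ring
  have h2 : (x + (1 / 2 : ℝ) * Complex.I : ℂ) = x + Complex.I / 2 := by
    push_cast
    ring
  rw [h1, h2, ← mul_assoc, (meixnerPollaczek_eq_shift ν x n).1]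
  simp only [hF_def]
  rw [gammaWeight_sub_half (by positivity), gammaWeight_add_half (by positivity)]
  push_cast
  ring

theorem integrable_meixnerPollaczek_mul {ν : ℝ} (hν : 0 < ν) (n m : ℕ) :
    Integrable fun x : ℝ =>
      meixnerPollaczek ν x n * meixnerPollaczek ν x m * gammaWeight (ν / 2) x :=
  ((polyGrowth_meixnerPollaczek ν n).mul
    (polyGrowth_meixnerPollaczek ν m)).integrable_mul_gammaWeight
    ((differentiable_meixnerPollaczek ν n).mul (differentiable_meixnerPollaczek ν m))
    (by positivity)

theorem integral_meixnerPollaczek_mul_of_lt {ν : ℝ} (hν : 0 < ν) {n m : ℕ} (hmn : m < n) :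
    ∫ x : ℝ, meixnerPollaczek ν x n * meixnerPollaczek ν x m * gammaWeight (ν / 2) x = 0 := by
  have hi := integrable_meixnerPollaczek_mul hν
  have hzero : ∀ {n : ℕ}, 0 < n →
      ∫ x : ℝ, meixnerPollaczek ν x n * meixnerPollaczek ν x 0 * gammaWeight (ν / 2) x = 0 := by
    intro n hn
    obtain ⟨n, rfl⟩ : ∃ k, n = k + 1 := ⟨n - 1, by omega⟩
    simpa using integral_meixnerPollaczek_succ hν n
  induction m using Nat.twoStepInduction generalizing n with
  | zero => exact hzero hmn
  | one =>
    obtain ⟨n, rfl⟩ : ∃ k, n = k + 1 := ⟨n - 1, by omega⟩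
    have h1 := hzero (n := n + 2) (by omega)
    have h2 := hzero (n := n) (by omega)
    calc _ = ∫ x : ℝ, ((n + 2) *
            (meixnerPollaczek ν x (n + 2) * meixnerPollaczek ν x 0 * gammaWeight (ν / 2) x) -
          (n + ν) *
            (meixnerPollaczek ν x n * meixnerPollaczek ν x 0 * gammaWeight (ν / 2) x)) := by
          congr 1 with x
          simp only [meixnerPollaczek_zero, meixnerPollaczek_one]
          linear_combination -gammaWeight (ν / 2) x * meixnerPollaczek_add_two ν x n
      _ = 0 := by
          rw [integral_sub ((hi _ _).const_mul _) ((hi _ _).const_mul _)]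
          simp only [integral_const_mul, h1, h2, mul_zero, sub_zero]
  | more m ih0 ih1 =>
    obtain ⟨n, rfl⟩ : ∃ k, n = k + 1 := ⟨n - 1, by omega⟩
    have h1 := ih1 (n := n + 2) (by omega)
    have h2 := ih1 (n := n) (by omega)
    have h3 := ih0 (n := n + 1) (by omega)
    refine mul_left_cancel₀ (show (m + 2 : ℂ) ≠ 0 by exact_mod_cast (by omega : m + 2 ≠ 0)) ?_
    rw [mul_zero, ← integral_const_mul]
    calc _ = ∫ x : ℝ, ((n + 2) *
            (meixnerPollaczek ν x (n + 2) * meixnerPollaczek ν x (m + 1) * gammaWeight (ν / 2) x) -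
          (n + ν) *
            (meixnerPollaczek ν x n * meixnerPollaczek ν x (m + 1) * gammaWeight (ν / 2) x)) +
          (m + ν) *
            (meixnerPollaczek ν x (n + 1) * meixnerPollaczek ν x m * gammaWeight (ν / 2) x) := by
          congr 1 with x
          linear_combination
            (meixnerPollaczek ν x (n + 1) * gammaWeight (ν / 2) x) * meixnerPollaczek_add_two ν x m -
            (meixnerPollaczek ν x (m + 1) * gammaWeight (ν / 2) x) * meixnerPollaczek_add_two ν x n
      _ = 0 := by
          refine (integral_add (((hi _ _).const_mul _).sub ((hi _ _).const_mul _))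
            ((hi _ _).const_mul _)).trans ?_
          rw [integral_sub' ((hi _ _).const_mul _) ((hi _ _).const_mul _)]
          simp only [integral_const_mul, h1, h2, h3, mul_zero, sub_zero, add_zero]

theorem integral_meixnerPollaczek_mul_of_ne {ν : ℝ} (hν : 0 < ν) {n m : ℕ} (hnm : n ≠ m) :
    ∫ x : ℝ, meixnerPollaczek ν x n * meixnerPollaczek ν x m * gammaWeight (ν / 2) x = 0 := by
  rcases hnm.lt_or_gt with h | h
  · simpa only [mul_comm (meixnerPollaczek ν _ m)] using integral_meixnerPollaczek_mul_of_lt hν h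
  · exact integral_meixnerPollaczek_mul_of_lt hν h

theorem meixner_pollaczek_orthogonality (ν : ℝ) (hν : 0 < ν) (n m : ℕ) (hnm : n ≠ m)
    (p : ℝ → ℕ → ℂ)
    (hp : ∀ lam : ℝ, ∃ r > 0, ∀ x : ℝ, |x| < r →
      HasSum (fun k : ℕ => p lam k * (x : ℂ) ^ k) (GFun ν (lam : ℂ) x)) :
    Integrable (fun lam : ℝ =>
      p lam n * (starRingEnd ℂ) (p lam m) *
        ((‖Complex.Gamma ((ν / 2 : ℝ) + Complex.I * lam)‖ ^ 2 : ℝ) : ℂ)) volume ∧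
    ∫ lam : ℝ,
      p lam n * (starRingEnd ℂ) (p lam m) *
        ((‖Complex.Gamma ((ν / 2 : ℝ) + Complex.I * lam)‖ ^ 2 : ℝ) : ℂ) = 0 := by
  have hq : ∀ (lam : ℝ) (k : ℕ), p lam k = meixnerPollaczek ν lam k := fun lam k => by
    obtain ⟨r, hr, h⟩ := hp lam
    exact eq_meixnerPollaczek_of_hasSum_GFun hr h k
  have hfun : ∀ lam : ℝ, p lam n * (starRingEnd ℂ) (p lam m) *
      ((‖Complex.Gamma ((ν / 2 : ℝ) + Complex.I * lam)‖ ^ 2 : ℝ) : ℂ) =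
      (-1) ^ m * (meixnerPollaczek ν lam n * meixnerPollaczek ν lam m *
        gammaWeight (ν / 2) lam) := fun lam => by
    rw [hq, hq, conj_meixnerPollaczek, ← gammaWeight_ofReal]
    ring
  simp only [hfun]
  refine ⟨(integrable_meixnerPollaczek_mul hν n m).const_mul _, ?_⟩
  rw [integral_const_mul, integral_meixnerPollaczek_mul_of_ne hν hnm, mul_zero]
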